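/- arXiv:2411.17327 — 2 statements merged into one kernel-verified Lean document; each statement's English description precedes it below -/
import Mathlib

section
/- Let f : ℕ_{>0} → ℝ be a nonnegative sequence, let t be a nonzero real number, and let F be defined by F(z) = Σ_{n=1}^{∞} f(n)/(n+z) (the series being convergent at every point where F is evaluated below). Fix β with |β| ≤ 1 and assume that the series Σ_{k=1}^{∞} (−1)^k e^{πikβ}(F(k−it)−F(k+it)) and Σ_{k=1}^{∞} (−1)^k e^{−πikβ}(F(−k−it)−F(−k+it)) converge absolutely. Then the series Σ_{n=1}^{∞} (−1)^n e^{−πinβ} f(n) converges and (π·cosh(πβt)/sinh(πt))·Σ_{n=1}^{∞} (−1)^n e^{−πinβ} f(n) = (F(−it)−F(it))/(2i) + (1/(2i))·Σ_{k=1}^{∞} (−1)^k e^{πikβ}(F(k−it)−F(k+it)) + (1/(2i))·Σ_{k=1}^{∞} (−1)^k e^{−πikβ}(F(−k−it)−F(−k+it)). -/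
open Filter

lemma exp_pi_mul_I_mul_int_sub (w : ℂ) (n : ℤ) :
    Complex.exp (w - Real.pi * Complex.I * n) =
      Complex.exp (Real.pi * Complex.I * n) * Complex.exp w := by
  rw [← Complex.exp_add, Complex.exp_eq_exp_iff_exists_int]
  exact ⟨-n, by push_cast; ring⟩

lemma integral_fourier_mul_cosh {t : ℝ} (ht : t ≠ 0) (n : ℤ) :
    ∫ x in (-1 : ℝ)..1, Complex.exp (-(Real.pi * Complex.I * n * x)) *
        Complex.cosh (Real.pi * t * x) =
      2 * Complex.exp (Real.pi * Complex.I * n) * (t * Complex.sinh (Real.pi * t)) /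
        (Real.pi * (n ^ 2 + t ^ 2)) := by
  have hπ : (Real.pi : ℂ) ≠ 0 := by exact_mod_cast Real.pi_ne_zero
  have ha : (t : ℂ) - Complex.I * n ≠ 0 := fun h => ht (by simpa using congrArg Complex.re h)
  have hb : (t : ℂ) + Complex.I * n ≠ 0 := fun h => ht (by simpa using congrArg Complex.re h)
  have hab : (n : ℂ) ^ 2 + t ^ 2 = (t - Complex.I * n) * (t + Complex.I * n) := by
    linear_combination (n : ℂ) ^ 2 * Complex.I_sq
  have key : ∀ x : ℝ, Complex.exp (-(Real.pi * Complex.I * n * x)) *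
      Complex.cosh (Real.pi * t * x) =
      (1 / 2) * Complex.exp (Real.pi * (t - Complex.I * n) * x) +
        (1 / 2) * Complex.exp (-(Real.pi * (t + Complex.I * n)) * x) := by
    intro x
    rw [Complex.cosh, mul_div_assoc', mul_add, ← Complex.exp_add, ← Complex.exp_add]
    ring_nf
  simp_rw [key]
  rw [intervalIntegral.integral_add, intervalIntegral.integral_const_mul,
    intervalIntegral.integral_const_mul, integral_exp_mul_complex (mul_ne_zero hπ ha),
    integral_exp_mul_complex (neg_ne_zero.2 (mul_ne_zero hπ hb)), hab, Complex.sinh]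
  · have e1 := exp_pi_mul_I_mul_int_sub (Real.pi * t) n
    have e2 := exp_pi_mul_I_mul_int_sub (-(Real.pi * t)) n
    have e3 : Complex.exp (Real.pi * t + Real.pi * Complex.I * n) =
        Complex.exp (Real.pi * Complex.I * n) * Complex.exp (Real.pi * t) := by
      rw [← Complex.exp_add, add_comm]
    have e4 : Complex.exp (-(Real.pi * t) + Real.pi * Complex.I * n) =
        Complex.exp (Real.pi * Complex.I * n) * Complex.exp (-(Real.pi * t)) := by
      rw [← Complex.exp_add, add_comm]
    have r1 : Real.pi * (t - Complex.I * n) * ((1 : ℝ) : ℂ) =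
      Real.pi * t - Real.pi * Complex.I * n := by push_cast; ring
    have r2 : Real.pi * (t - Complex.I * n) * ((-1 : ℝ) : ℂ) =
      -(Real.pi * t) + Real.pi * Complex.I * n := by push_cast; ring
    have r3 : -(Real.pi * (t + Complex.I * n)) * ((1 : ℝ) : ℂ) =
      -(Real.pi * t) - Real.pi * Complex.I * n := by push_cast; ring
    have r4 : -(Real.pi * (t + Complex.I * n)) * ((-1 : ℝ) : ℂ) =
      Real.pi * t + Real.pi * Complex.I * n := by push_cast; ring
    rw [r1, r2, r3, r4, e1, e2, e3, e4]
    field_simp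
    ring
  all_goals exact Continuous.intervalIntegrable (by fun_prop) _ _

lemma summable_int_inv_sq_add_sq {t : ℝ} (ht : t ≠ 0) :
    Summable fun n : ℤ => 1 / ((n : ℝ) ^ 2 + t ^ 2) := by
  refine Summable.of_norm_bounded_eventually
    (Real.summable_one_div_int_pow.2 one_lt_two) ?_
  filter_upwards [(Set.finite_singleton (0 : ℤ)).compl_mem_cofinite] with n hn
  have hn' : (n : ℝ) ≠ 0 := by exact_mod_cast hn
  rw [Real.norm_of_nonneg (by positivity)]
  gcongr
  nlinarith [sq_nonneg t]

/-- Fourier expansion of `cosh` on `[-1, 1]`. -/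
lemma hasSum_exp_div_sq_add_sq {t : ℝ} (ht : t ≠ 0) {β : ℝ} (hβ : |β| ≤ 1) :
    HasSum (fun n : ℤ => Complex.exp (Real.pi * Complex.I * (1 + β) * n) *
        ((1 / ((n : ℝ) ^ 2 + t ^ 2) : ℝ) : ℂ))
      ((Real.pi * Real.cosh (Real.pi * β * t) / (t * Real.sinh (Real.pi * t)) : ℝ) : ℂ) := by
  have : Fact (0 < (2 : ℝ)) := ⟨two_pos⟩
  have hπ : (Real.pi : ℂ) ≠ 0 := by exact_mod_cast Real.pi_ne_zero
  have ht' : (t : ℂ) ≠ 0 := by exact_mod_cast ht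
  have hs : Complex.sinh (Real.pi * t) ≠ 0 := by
    have : Real.sinh (Real.pi * t) ≠ 0 := by
      rw [Ne, Real.sinh_eq_zero]; exact mul_ne_zero Real.pi_ne_zero ht
    exact_mod_cast this
  let g : ℝ → ℂ := fun x => Complex.cosh (Real.pi * t * x)
  have hg : Continuous g := by fun_prop
  have hend : g (-1) = g (-1 + 2) := by
    norm_num [g]
  let G : C(AddCircle (2 : ℝ), ℂ) :=
    ⟨AddCircle.liftIco 2 (-1) g, AddCircle.liftIco_continuous hend hg.continuousOn⟩
  have hcoeff : ∀ n : ℤ, fourierCoeff G n = Complex.exp (Real.pi * Complex.I * n) *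
      (t * Complex.sinh (Real.pi * t)) / Real.pi * ((1 / ((n : ℝ) ^ 2 + t ^ 2) : ℝ) : ℂ) := by
    intro n
    change fourierCoeff (AddCircle.liftIco 2 (-1) g) n = _
    rw [fourierCoeff_liftIco_eq, fourierCoeffOn_eq_integral]
    have := integral_fourier_mul_cosh ht n
    simp only [fourier_coe_apply, smul_eq_mul, g]
    rw [show (-1 + 2 : ℝ) = 1 by norm_num]
    rw [show (1 - -1 : ℝ) = 2 by norm_num]
    have hint : ∀ x : ℝ, Complex.exp (2 * Real.pi * Complex.I * ((-n : ℤ) : ℂ) * x / (2 : ℝ)) =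
        Complex.exp (-(Real.pi * Complex.I * n * x)) := by
      intro x; congr 1; push_cast; ring
    simp_rw [hint]
    rw [this, Complex.real_smul]
    push_cast
    simp only [div_eq_mul_inv, mul_inv]
    ring
  have hG : G (β : AddCircle (2 : ℝ)) = Complex.cosh (Real.pi * β * t) := by
    obtain ⟨h1, h2⟩ := abs_le.1 hβ
    rcases h2.lt_or_eq with h | rfl
    · change AddCircle.liftIco 2 (-1) g _ = _
      rw [AddCircle.liftIco_coe_apply ⟨h1, by linarith⟩]
      simp only [g]; ring_nf
    · have : ((1 : ℝ) : AddCircle (2 : ℝ)) = ((-1 : ℝ) : AddCircle (2 : ℝ)) := by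
        rw [← AddCircle.coe_add_period 2 (-1)]; norm_num
      rw [this]
      change AddCircle.liftIco 2 (-1) g _ = _
      rw [AddCircle.liftIco_coe_apply ⟨le_rfl, by norm_num⟩]
      simp [g]
  have hsum : Summable (fourierCoeff G) := by
    refine Summable.of_norm ?_
    have hn : ∀ n : ℤ, ‖fourierCoeff G n‖ =
        ‖t * Complex.sinh (Real.pi * t) / Real.pi‖ * (1 / ((n : ℝ) ^ 2 + t ^ 2)) := by
      intro n
      have he : ‖Complex.exp (Real.pi * Complex.I * n)‖ = 1 := by
        rw [Complex.norm_exp]; simp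
      rw [hcoeff, mul_div_assoc, norm_mul, norm_mul, he, one_mul, Complex.norm_real,
        Real.norm_of_nonneg (by positivity)]
    simp_rw [hn]
    exact (summable_int_inv_sq_add_sq ht).mul_left _
  have h := has_pointwise_sum_fourier_series_of_summable hsum (β : AddCircle (2 : ℝ))
  rw [hG] at h
  convert! h.mul_left (Real.pi / (t * Complex.sinh (Real.pi * t))) using 2 with n
  · have he : Complex.exp (Real.pi * Complex.I * (1 + β) * n) =
        Complex.exp (Real.pi * Complex.I * n) *
          Complex.exp (2 * Real.pi * Complex.I * n * β / (2 : ℝ)) := by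
      rw [← Complex.exp_add]; congr 1; push_cast; ring
    rw [hcoeff, fourier_coe_apply, he, smul_eq_mul]
    field_simp
  · push_cast; ring

/-- Interchange of summation for a convolution with a unimodular character of `ℤ`. -/
lemma hasSum_character_mul_of_hasSum_convolution
    {a : ℕ → ℝ} (ha : ∀ n, 0 ≤ a n) {q : ℤ → ℝ} (hq : ∀ m, 0 ≤ q m)
    {e : ℤ → ℂ} (he : ∀ m, ‖e m‖ = 1) (hadd : ∀ m n, e (m + n) = e m * e n)
    {D : ℤ → ℂ} (hD : ∀ k : ℤ, HasSum (fun n : ℕ => ((a n * q (n + 1 + k) : ℝ) : ℂ)) (D k))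
    (hs : Summable fun k => ‖e k * D k‖)
    {C : ℂ} (hC : HasSum (fun m : ℤ => e m * q m) C) (hC0 : C ≠ 0) :
    HasSum (fun n : ℕ => e (-(n + 1)) * a n) ((∑' k, e k * D k) / C) := by
  have hR : ∀ k : ℤ, HasSum (fun n : ℕ => a n * q (n + 1 + k)) ‖D k‖ := by
    intro k
    have hsum := Complex.summable_ofReal.1 (hD k).summable
    have hval : D k = ((∑' n : ℕ, a n * q (n + 1 + k) : ℝ) : ℂ) :=
      (hD k).unique (Complex.hasSum_ofReal.2 hsum.hasSum)
    rw [hval, Complex.norm_real,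
      Real.norm_of_nonneg (tsum_nonneg fun n => mul_nonneg (ha n) (hq _))]
    exact hsum.hasSum
  let H : ℤ × ℕ → ℂ := fun p => e p.1 * ((a p.2 * q (p.2 + 1 + p.1) : ℝ) : ℂ)
  have hH : Summable H := by
    refine Summable.of_norm ?_
    have hn : ∀ p, ‖H p‖ = a p.2 * q (p.2 + 1 + p.1) := fun p => by
      rw [norm_mul, he, one_mul, Complex.norm_real,
        Real.norm_of_nonneg (mul_nonneg (ha _) (hq _))]
    rw [summable_prod_of_nonneg fun p => norm_nonneg _]
    simp_rw [hn]
    refine ⟨fun k => (hR k).summable, ?_⟩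
    simp_rw [fun k => (hR k).tsum_eq]
    simpa [he] using hs
  have hrow : HasSum (fun k => e k * D k) (∑' p, H p) :=
    hH.hasSum.prod_fiberwise fun k => (hD k).mul_left (e k)
  have hcol : HasSum (fun n : ℕ => e (-(n + 1)) * a n * C) (∑' p, H p) := by
    have hswap : HasSum (fun p : ℕ × ℤ => H (p.2, p.1)) (∑' p, H p) :=
      (Equiv.prodComm ℕ ℤ).hasSum_iff.2 hH.hasSum
    refine hswap.prod_fiberwise fun n => ?_
    rw [← (Equiv.subRight ((n : ℤ) + 1)).hasSum_iff]
    convert! hC.mul_left (e (-(n + 1)) * a n) using 2 with m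
    simp only [H, Function.comp_apply, Equiv.subRight_apply]
    rw [sub_eq_add_neg, hadd, show (n : ℤ) + 1 + (m + -(n + 1)) = m by ring]
    push_cast
    ring
  rw [hrow.tsum_eq]
  simpa [hC0] using hcol.div_const C

lemma hasSum_div_sq_add_sq {a : ℕ → ℝ} {t : ℝ} (ht : t ≠ 0) {F : ℂ → ℂ}
    (hF : ∀ z : ℂ, z.im ≠ 0 →
      HasSum (fun n : ℕ => (a n : ℂ) / (((n : ℂ) + 1) + z)) (F z)) (k : ℤ) :
    HasSum (fun n : ℕ => ((a n * (1 / (((n + 1 + k : ℤ) : ℝ) ^ 2 + t ^ 2)) : ℝ) : ℂ))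
      ((F (k - Complex.I * t) - F (k + Complex.I * t)) / (2 * Complex.I * t)) := by
  have ht' : (t : ℂ) ≠ 0 := by exact_mod_cast ht
  have hm := hF (k - Complex.I * t) (by simpa using ht)
  have hp := hF (k + Complex.I * t) (by simpa using ht)
  convert! (hm.sub hp).div_const (2 * Complex.I * t) using 2 with n
  have h1 : (n : ℂ) + 1 + (k - Complex.I * t) ≠ 0 :=
    fun h => ht (by simpa using congrArg Complex.im h)
  have h2 : (n : ℂ) + 1 + (k + Complex.I * t) ≠ 0 :=
    fun h => ht (by simpa using congrArg Complex.im h)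
  have h3 : ((n : ℂ) + 1 + k) ^ 2 + t ^ 2 =
      (n + 1 + (k - Complex.I * t)) * (n + 1 + (k + Complex.I * t)) := by
    linear_combination (t : ℂ) ^ 2 * Complex.I_sq
  push_cast
  rw [h3]
  have hI := Complex.I_ne_zero
  field_simp
  ring

lemma neg_one_pow_mul_exp (k : ℕ) (β : ℂ) :
    (-1 : ℂ) ^ (k + 1) * Complex.exp (Real.pi * Complex.I * ((k : ℂ) + 1) * β) =
      Complex.exp (Real.pi * Complex.I * (1 + β) * ((k + 1 : ℤ) : ℂ)) := by
  rw [← Complex.exp_pi_mul_I, ← Complex.exp_nat_mul, ← Complex.exp_add]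
  congr 1; push_cast; ring

lemma neg_one_pow_mul_exp_neg (k : ℕ) (β : ℂ) :
    (-1 : ℂ) ^ (k + 1) * Complex.exp (-(Real.pi * Complex.I * ((k : ℂ) + 1) * β)) =
      Complex.exp (Real.pi * Complex.I * (1 + β) * ((-(k + 1) : ℤ) : ℂ)) := by
  rw [← Complex.exp_pi_mul_I, ← Complex.exp_nat_mul, ← Complex.exp_add,
    Complex.exp_eq_exp_iff_exists_int]
  exact ⟨k + 1, by push_cast; ring⟩

/-- Lemma 4 of the paper. -/
theorem statement0
    (f : ℕ → ℝ) (hf : ∀ n, 1 ≤ n → 0 ≤ f n)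
    (t : ℝ) (ht : t ≠ 0)
    (F : ℂ → ℂ)
    (hF : ∀ z : ℂ, z.im ≠ 0 →
      HasSum (fun n : ℕ => (f (n + 1) : ℂ) / (((n : ℂ) + 1) + z)) (F z))
    (β : ℝ) (hβ : |β| ≤ 1)
    (h1 : Summable (fun k : ℕ =>
      ‖(-1 : ℂ) ^ (k + 1) *
        Complex.exp (Real.pi * Complex.I * ((k : ℂ) + 1) * (β : ℂ)) *
        (F (((k : ℂ) + 1) - Complex.I * (t : ℂ)) - F (((k : ℂ) + 1) + Complex.I * (t : ℂ)))‖))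
    (h2 : Summable (fun k : ℕ =>
      ‖(-1 : ℂ) ^ (k + 1) *
        Complex.exp (-(Real.pi * Complex.I * ((k : ℂ) + 1) * (β : ℂ))) *
        (F (-((k : ℂ) + 1) - Complex.I * (t : ℂ)) - F (-((k : ℂ) + 1) + Complex.I * (t : ℂ)))‖)) :
    ∃ S : ℂ,
      HasSum (fun n : ℕ => (-1 : ℂ) ^ (n + 1) *
        Complex.exp (-(Real.pi * Complex.I * ((n : ℂ) + 1) * (β : ℂ))) * (f (n + 1) : ℂ)) S ∧
      ((Real.pi * Real.cosh (Real.pi * β * t) / Real.sinh (Real.pi * t) : ℝ) : ℂ) * S =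
        (F (-(Complex.I * (t : ℂ))) - F (Complex.I * (t : ℂ))) / (2 * Complex.I)
        + (1 / (2 * Complex.I)) *
            ∑' k : ℕ, (-1 : ℂ) ^ (k + 1) *
              Complex.exp (Real.pi * Complex.I * ((k : ℂ) + 1) * (β : ℂ)) *
              (F (((k : ℂ) + 1) - Complex.I * (t : ℂ)) - F (((k : ℂ) + 1) + Complex.I * (t : ℂ)))
        + (1 / (2 * Complex.I)) *
            ∑' k : ℕ, (-1 : ℂ) ^ (k + 1) *
              Complex.exp (-(Real.pi * Complex.I * ((k : ℂ) + 1) * (β : ℂ))) *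
              (F (-((k : ℂ) + 1) - Complex.I * (t : ℂ)) - F (-((k : ℂ) + 1) + Complex.I * (t : ℂ))) := by
  have ht' : (t : ℂ) ≠ 0 := by exact_mod_cast ht
  have hI := Complex.I_ne_zero
  let e : ℤ → ℂ := fun m => Complex.exp (Real.pi * Complex.I * (1 + β) * m)
  let D : ℤ → ℂ := fun k =>
    (F (k - Complex.I * t) - F (k + Complex.I * t)) / (2 * Complex.I * t)
  let P : ℕ → ℂ := fun k => (-1 : ℂ) ^ (k + 1) *
    Complex.exp (Real.pi * Complex.I * ((k : ℂ) + 1) * (β : ℂ)) *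
    (F (((k : ℂ) + 1) - Complex.I * (t : ℂ)) - F (((k : ℂ) + 1) + Complex.I * (t : ℂ)))
  let N : ℕ → ℂ := fun k => (-1 : ℂ) ^ (k + 1) *
    Complex.exp (-(Real.pi * Complex.I * ((k : ℂ) + 1) * (β : ℂ))) *
    (F (-((k : ℂ) + 1) - Complex.I * (t : ℂ)) - F (-((k : ℂ) + 1) + Complex.I * (t : ℂ)))
  let C : ℝ := Real.pi * Real.cosh (Real.pi * β * t) / (t * Real.sinh (Real.pi * t))
  have hsinh : Real.sinh (Real.pi * t) ≠ 0 := by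
    rw [Ne, Real.sinh_eq_zero]; exact mul_ne_zero Real.pi_ne_zero ht
  have hC0 : (C : ℂ) ≠ 0 := by
    have : C ≠ 0 := div_ne_zero (mul_ne_zero Real.pi_ne_zero (Real.cosh_pos _).ne')
      (mul_ne_zero ht hsinh)
    exact_mod_cast this
  have he : ∀ m, ‖e m‖ = 1 := fun m => by
    simp [e, Complex.norm_exp]
  have hadd : ∀ m n, e (m + n) = e m * e n := fun m n => by
    simp only [e]
    rw [← Complex.exp_add]; congr 1; push_cast; ring
  have hpos : ∀ k : ℕ, e (k + 1) * D (k + 1) = P k / (2 * Complex.I * t) := fun k => by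
    simp only [e, D, P]
    rw [neg_one_pow_mul_exp]; push_cast; ring
  have hneg : ∀ k : ℕ, e (-(k + 1)) * D (-(k + 1)) = N k / (2 * Complex.I * t) := fun k => by
    simp only [e, D, N]
    rw [neg_one_pow_mul_exp_neg, mul_div_assoc]; push_cast; rfl
  have hsum : Summable fun k => ‖e k * D k‖ := by
    refine Summable.of_add_one_of_neg_add_one ?_ ?_
    · simp_rw [hpos, norm_div]
      exact Summable.div_const h1 _
    · simp_rw [hneg, norm_div]
      exact Summable.div_const h2 _
  have htsum : ∑' k, e k * D k = (∑' k, P k) / (2 * Complex.I * t) +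
      (F (-(Complex.I * t)) - F (Complex.I * t)) / (2 * Complex.I * t) +
      (∑' k, N k) / (2 * Complex.I * t) := by
    have h := HasSum.of_add_one_of_neg_add_one (f := fun k => e k * D k)
      (m := (∑' k, P k) / (2 * Complex.I * t)) (m' := (∑' k, N k) / (2 * Complex.I * t))
      (by simpa only [hpos] using (Summable.of_norm h1).hasSum.div_const _)
      (by simpa only [hneg] using (Summable.of_norm h2).hasSum.div_const _)
    rw [h.tsum_eq]
    simp [e, D]
  have hmain := hasSum_character_mul_of_hasSum_convolution
    (a := fun n => f (n + 1)) (fun n => hf _ (Nat.le_add_left 1 n))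
    (q := fun m : ℤ => 1 / ((m : ℝ) ^ 2 + t ^ 2)) (fun m => by positivity)
    he hadd (D := D) (fun k => hasSum_div_sq_add_sq ht hF k) hsum
    (hasSum_exp_div_sq_add_sq ht hβ) hC0
  refine ⟨(∑' k, e k * D k) / C, ?_, ?_⟩
  · simp_rw [neg_one_pow_mul_exp_neg]
    exact hmain
  · have hCt : ((Real.pi * Real.cosh (Real.pi * β * t) / Real.sinh (Real.pi * t) : ℝ) : ℂ) =
        C * t := by
      rw [← Complex.ofReal_mul]
      congr 1
      simp only [C]
      field_simp
    change _ = _ + (1 / (2 * Complex.I)) * ∑' k, P k + (1 / (2 * Complex.I)) * ∑' k, N k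
    rw [hCt, htsum]
    field_simp
    ring
end

section
/- Let k ≥ 1 be a natural number and let z be a complex number with z ≠ 0 and z ≠ −k·m^2 for every natural number m ≥ 1. Then Σ_{n=1}^{∞} q_k(n)/(n^2·(n+z)) = π^4/(90·k^2·z) − π^2/(6·k·z^2) − 1/(2·z^3) + π·cosh(π·√z/√k)/(2·z^2·√(z·k)·sinh(π·√z/√k)), where √ denotes the principal complex square root. -/
open scoped Classical

/-- `qf k N = 1` if `N = k·m²` for some natural `m ≥ 1`, and `0` otherwise. -/
noncomputable def qf (k N : ℕ) : ℝ :=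
  if ∃ m : ℕ, 1 ≤ m ∧ N = k * m ^ 2 then 1 else 0

open Complex in
/-- The Mittag-Leffler expansion of the hyperbolic cotangent. -/
theorem hasSum_inv_sq_add_sq (a : ℂ) (ha : a ≠ 0)
    (ha' : ∀ m : ℕ, 1 ≤ m → a ^ 2 ≠ -(m : ℂ) ^ 2) :
    HasSum (fun n : ℕ => 1 / (((n : ℂ) + 1) ^ 2 + a ^ 2))
      (Real.pi * cosh (Real.pi * a) / (2 * a * sinh (Real.pi * a)) - 1 / (2 * a ^ 2)) := by
  have hx : a * I ∈ integerComplement := by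
    rintro ⟨m, hm⟩
    have hsq : a ^ 2 = -((m.natAbs : ℕ) : ℂ) ^ 2 := by
      have h1 : ((m.natAbs : ℕ) : ℂ) ^ 2 = (m : ℂ) ^ 2 := by
        have h := congrArg (Int.cast : ℤ → ℂ) (Int.natAbs_sq m)
        push_cast at h
        simpa using h
      rw [h1, hm, mul_pow, I_sq]
      ring
    rcases Nat.eq_zero_or_pos m.natAbs with h0 | h0
    · rw [h0] at hsq
      simp [ha] at hsq
    · exact ha' _ h0 hsq
  have hsum := (summable_cotTerm hx).hasSum
  rw [show (∑' n, cotTerm (a * I) n) = _ from (cot_series_rep' hx).symm] at hsum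
  have hs : sinh (Real.pi * a) ≠ 0 := by
    have h := sin_pi_mul_ne_zero hx
    rw [← mul_assoc, sin_mul_I] at h
    exact left_ne_zero_of_mul h
  convert! hsum.mul_left (I / (2 * a)) using 1
  · ext n
    rw [cotTerm_identity hx]
    have hd : ((n : ℂ) + 1) ^ 2 + a ^ 2 ≠ 0 := by
      have h := ha' (n + 1) (by omega)
      push_cast at h
      contrapose! h
      linear_combination h
    have he : (a * I + (n + 1)) * (a * I - (n + 1)) = -(((n : ℂ) + 1) ^ 2 + a ^ 2) := by
      linear_combination a ^ 2 * I_sq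
    rw [he]
    field_simp
    linear_combination I_sq
  · rw [← mul_assoc, cot, cos_mul_I, sin_mul_I]
    field_simp

theorem mul_natCast_cpow_half (k : ℕ) (hk : 1 ≤ k) (z : ℂ) (hz : z ≠ 0) :
    (z * (k : ℂ)) ^ ((1 : ℂ) / 2) = z ^ ((1 : ℂ) / 2) * (Real.sqrt k : ℂ) := by
  have hk0 : (0 : ℝ) < k := by exact_mod_cast hk
  have hkc : (k : ℂ) ≠ 0 := by exact_mod_cast hk0.ne'
  have hlog := Complex.log_mul_ofReal (k : ℝ) hk0 z hz
  rw [Complex.ofReal_natCast] at hlog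
  rw [Complex.cpow_def_of_ne_zero (mul_ne_zero hz hkc), Complex.cpow_def_of_ne_zero hz, hlog,
    Real.sqrt_eq_rpow, Real.rpow_def_of_pos hk0, add_mul, Complex.exp_add, mul_comm]
  push_cast
  rfl

/-- Lemma 6 of the paper. -/
theorem statement2
    (k : ℕ) (hk : 1 ≤ k) (z : ℂ) (hz : z ≠ 0)
    (hz' : ∀ m : ℕ, 1 ≤ m → z ≠ -((k : ℂ) * (m : ℂ) ^ 2)) :
    HasSum (fun n : ℕ =>
      (qf k (n + 1) : ℂ) / (((n : ℂ) + 1) ^ 2 * (((n : ℂ) + 1) + z)))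
      ((Real.pi : ℂ) ^ 4 / (90 * (k : ℂ) ^ 2 * z)
        - (Real.pi : ℂ) ^ 2 / (6 * (k : ℂ) * z ^ 2)
        - 1 / (2 * z ^ 3)
        + (Real.pi : ℂ) * Complex.cosh ((Real.pi : ℂ) * z ^ ((1 : ℂ)/2) / (Real.sqrt k : ℂ)) /
            (2 * z ^ 2 * (z * (k : ℂ)) ^ ((1 : ℂ)/2) *
              Complex.sinh ((Real.pi : ℂ) * z ^ ((1 : ℂ)/2) / (Real.sqrt k : ℂ)))) := by
  have hk0 : k ≠ 0 := by omega
  have hkc : (k : ℂ) ≠ 0 := by exact_mod_cast hk0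
  have hinj : Function.Injective (fun m : ℕ => k * (m + 1) ^ 2 - 1) := by
    intro a b hab
    have h1 : 0 < k * (a + 1) ^ 2 := by positivity
    have h2 : 0 < k * (b + 1) ^ 2 := by positivity
    have h3 : k * (a + 1) ^ 2 = k * (b + 1) ^ 2 := by
      simp only at hab
      omega
    have h4 := Nat.pow_left_injective (n := 2) (by norm_num)
      (Nat.eq_of_mul_eq_mul_left (by omega) h3)
    omega
  rw [← hinj.hasSum_iff]
  swap
  · intro n hn
    have : qf k (n + 1) = 0 := by
      rw [qf, if_neg]
      rintro ⟨m, hm, h⟩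
      refine hn ⟨m - 1, ?_⟩
      simp only [Nat.sub_add_cancel hm]
      omega
    simp [this]
  rw [mul_natCast_cpow_half k hk z hz]
  set w : ℂ := z ^ ((1 : ℂ) / 2) with hw
  set s : ℂ := (Real.sqrt k : ℂ) with hs
  have hw2 : w ^ 2 = z := by
    rw [hw, one_div]
    exact Complex.cpow_nat_inv_pow z two_ne_zero
  have hs2 : s ^ 2 = k := by
    rw [hs]
    exact_mod_cast congrArg (Complex.ofReal) (Real.sq_sqrt (Nat.cast_nonneg (α := ℝ) k))
  have hw0 : w ≠ 0 := by
    intro h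
    exact hz (by simpa [h] using hw2.symm)
  have hs0 : s ≠ 0 := by
    intro h
    exact hkc (by simpa [h] using hs2.symm)
  have hsq : (w / s) ^ 2 = z / k := by rw [div_pow, hw2, hs2]
  have hcoth := hasSum_inv_sq_add_sq (w / s) (div_ne_zero hw0 hs0) (by
    intro m hm h
    rw [hsq, div_eq_iff hkc] at h
    exact hz' m hm (by rw [h]; ring))
  have hz2 : HasSum (fun n : ℕ => 1 / ((n : ℂ) + 1) ^ 2) ((Real.pi : ℂ) ^ 2 / 6) := by
    have h := (hasSum_nat_add_iff' 1).mpr hasSum_zeta_two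
    have h' := Complex.hasSum_ofReal.mpr h
    simpa using h'
  have hz4 : HasSum (fun n : ℕ => 1 / ((n : ℂ) + 1) ^ 4) ((Real.pi : ℂ) ^ 4 / 90) := by
    have h := (hasSum_nat_add_iff' 1).mpr hasSum_zeta_four
    have h' := Complex.hasSum_ofReal.mpr h
    simpa using h'
  convert! ((hz4.mul_left (1 / (k ^ 2 * z))).sub (hz2.mul_left (1 / (k * z ^ 2)))).add
    (hcoth.mul_left (1 / (k * z ^ 2))) using 1
  · ext m
    have hq : qf k (k * (m + 1) ^ 2 - 1 + 1) = 1 := by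
      have h1 : 0 < k * (m + 1) ^ 2 := by positivity
      rw [qf, if_pos ⟨m + 1, by omega, by omega⟩]
    have hc : (((k * (m + 1) ^ 2 - 1 : ℕ) : ℂ) + 1) = k * ((m : ℂ) + 1) ^ 2 := by
      have h1 : 1 ≤ k * (m + 1) ^ 2 := Nat.succ_le_of_lt (by positivity)
      rw [Nat.cast_sub h1]
      push_cast
      ring
    have hm0 : (m : ℂ) + 1 ≠ 0 := Nat.cast_add_one_ne_zero m
    have hd : (k : ℂ) * ((m : ℂ) + 1) ^ 2 + z ≠ 0 := by
      have h := hz' (m + 1) (by omega)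
      push_cast at h
      contrapose! h
      linear_combination h
    have he : ((m : ℂ) + 1) ^ 2 + (w / s) ^ 2 = (k * ((m : ℂ) + 1) ^ 2 + z) / k := by
      rw [hsq]
      field_simp
    simp only [Function.comp_apply]
    rw [hq, hc, he]
    push_cast
    field_simp
    ring
  · rw [hsq, mul_div_assoc (Real.pi : ℂ) w s]
    by_cases hsinh : Complex.sinh (Real.pi * (w / s)) = 0
    · rw [hsinh]
      simp only [mul_zero, div_zero]
      field_simp
      ring
    · rw [← hs2, ← hw2]
      field_simp
      ring
end
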